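/- arXiv:1705.04611 — 2 statements merged into one kernel-verified Lean document; each statement's English description precedes it below -/
import Mathlib

section
/- Let n ≥ 1. The projections ∂(Q_S) for nonempty S ⊆ Fin n lie in the fixed-point subring B_n of A_n, and for finite antichains A, A′ under inclusion consisting of nonempty subsets of Fin n, with weight functions l : A → ℕ and l′ : A′ → ℕ taking values ≥ 1, if (A, l) ≠ (A′, l′) then the projections ⊞_{S∈A} ⊞^{l(S)} ∂(Q_S) and ⊞_{S∈A′} ⊞^{l′(S)} ∂(Q_S) are not equivalent as idempotent matrices over the ring B_n. -/
noncomputable section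

/-- `H n` is the Hilbert space `ℓ²(ℕ^n)`. -/
abbrev Hn (n : ℕ) : Type := lp (fun _ : (Fin n → ℕ) => ℂ) 2

/-- the standard basis vector `δ_z`. -/
def delta {n : ℕ} (z : Fin n → ℕ) : Hn n := lp.single 2 z 1

/-- `T` is the `i`-th coordinate shift: `T δ_z = δ_{z + e_i}`. -/
def IsShift {n : ℕ} (i : Fin n) (T : Hn n →L[ℂ] Hn n) : Prop :=
  ∀ z : Fin n → ℕ, T (delta z) = delta (Function.update z i (z i + 1))

/-- The Toeplitz algebra `T_n`: the smallest norm-closed star-subalgebra of `B(H_n)`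
containing the coordinate shifts. -/
def Toeplitz (n : ℕ) : StarSubalgebra ℂ (Hn n →L[ℂ] Hn n) :=
  (StarAlgebra.adjoin ℂ {T : Hn n →L[ℂ] Hn n | ∃ i : Fin n, IsShift i T}).topologicalClosure
/-- Padding a matrix by zeros into an `N × N` matrix along an embedding `f`. -/
def padMat {R : Type*} [Semiring R] {ι : Type*} [Fintype ι] {N : ℕ}
    (f : ι ↪ Fin N) (P : Matrix ι ι R) : Matrix (Fin N) (Fin N) R :=
  fun i j => ∑ a : ι, ∑ b : ι, if f a = i ∧ f b = j then P a b else 0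

/-- Equivalence of (idempotent) matrices over a ring `R`: after enlarging by zero diagonal blocks
to a common size `N`, they are conjugate by an invertible `N × N` matrix. -/
def IdemEquiv {R : Type*} [Ring R] {ι κ : Type*} [Fintype ι] [Fintype κ]
    (P : Matrix ι ι R) (Q : Matrix κ κ R) : Prop :=
  ∃ (N : ℕ) (f : ι ↪ Fin N) (g : κ ↪ Fin N) (U : (Matrix (Fin N) (Fin N) R)ˣ),
    U.val * padMat f P * (U⁻¹).val = padMat g Q


/-- The two-sided ideal `J_n` of compact operators in the Toeplitz algebra `T_n`. -/
def compactIdeal (n : ℕ) : TwoSidedIdeal ↥(Toeplitz n) :=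
  TwoSidedIdeal.mk'
    {a : ↥(Toeplitz n) | IsCompactOperator ⇑(a : Hn n →L[ℂ] Hn n)}
    (by
      show IsCompactOperator ⇑(((0 : ↥(Toeplitz n)) : Hn n →L[ℂ] Hn n))
      simp only [ZeroMemClass.coe_zero, ContinuousLinearMap.coe_zero]
      exact isCompactOperator_zero)
    (fun {x y} hx hy => by
      show IsCompactOperator ⇑(((x + y : ↥(Toeplitz n)) : Hn n →L[ℂ] Hn n))
      simp only [AddMemClass.coe_add, ContinuousLinearMap.coe_add']
      exact hx.add hy)
    (fun {x} hx => by
      show IsCompactOperator ⇑(((-x : ↥(Toeplitz n)) : Hn n →L[ℂ] Hn n))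
      simp only [NegMemClass.coe_neg, ContinuousLinearMap.coe_neg']
      exact hx.neg)
    (fun {x y} hy => by
      show IsCompactOperator ⇑(((x * y : ↥(Toeplitz n)) : Hn n →L[ℂ] Hn n))
      have := hy.clm_comp (x : Hn n →L[ℂ] Hn n)
      simpa [Function.comp] using this)
    (fun {x y} hx => by
      show IsCompactOperator ⇑(((x * y : ↥(Toeplitz n)) : Hn n →L[ℂ] Hn n))
      have := hx.comp_clm (y : Hn n →L[ℂ] Hn n)
      simpa [Function.comp] using this)

/-- The quotient ring `A_n = T_n / J_n`, isomorphic to `C(S_H^{2n-1})`. -/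
def QuantumSphere (n : ℕ) : Type := (compactIdeal n).ringCon.Quotient

instance (n : ℕ) : Ring (QuantumSphere n) :=
  inferInstanceAs (Ring (compactIdeal n).ringCon.Quotient)


/-- The quotient map `∂ : T_n → A_n`. -/
def toSphere (n : ℕ) : ↥(Toeplitz n) →+* QuantumSphere n := (compactIdeal n).ringCon.mk'

open scoped Classical in
/-- `Q` is the orthogonal projection onto the closed span of `{δ_z : z_i = 0 for all i ∉ S}`,
characterized by its action on the orthonormal basis. -/
def IsQProj {n : ℕ} (S : Finset (Fin n)) (Q : Hn n →L[ℂ] Hn n) : Prop :=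
  ∀ z : Fin n → ℕ, Q (delta z) = if ∀ i ∉ S, z i = 0 then delta z else 0

/-- The block-diagonal projection `⊞_{S ∈ A} ⊞^{l(S)} q_S` over a ring `R`. -/
def antichainMatR {R : Type*} [Ring R] {n : ℕ}
    (A : Finset (Finset (Fin n))) (l : Finset (Fin n) → ℕ) (q : Finset (Fin n) → R) :
    Matrix ((S : {x // x ∈ A}) × Fin (l S.1)) ((S : {x // x ∈ A}) × Fin (l S.1)) R :=
  Matrix.diagonal fun p => q p.1.1

/-- The fixed-point subring `B_n` of `A_n` under a family of ring automorphisms. -/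
def fixedSubring {n : ℕ} (α : Circle → (QuantumSphere n →+* QuantumSphere n)) :
    Subring (QuantumSphere n) where
  carrier := {a | ∀ ζ, α ζ a = a}
  mul_mem' := fun ha hb ζ => by rw [map_mul, ha ζ, hb ζ]
  one_mem' := fun ζ => map_one (α ζ)
  add_mem' := fun ha hb ζ => by rw [map_add, ha ζ, hb ζ]
  zero_mem' := fun ζ => map_zero (α ζ)
  neg_mem' := fun ha ζ => by rw [map_neg, ha ζ]

/-- The block-diagonal projection `⊞_{S ∈ A} ⊞^{l(S)} q_S` with entries in the
fixed-point subring `B_n`. -/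
def antichainMatFix {n : ℕ} (α : Circle → (QuantumSphere n →+* QuantumSphere n))
    (A : Finset (Finset (Fin n))) (l : Finset (Fin n) → ℕ)
    (q : Finset (Fin n) → QuantumSphere n) (hq : ∀ S ∈ A, q S ∈ fixedSubring α) :
    Matrix ((S : {x // x ∈ A}) × Fin (l S.1)) ((S : {x // x ∈ A}) × Fin (l S.1))
      ↥(fixedSubring α) :=
  Matrix.diagonal fun p => ⟨q p.1.1, hq p.1.1 p.1.2⟩

section RankOfIdempotents

theorem padMat_diagonal {R ι : Type*} [Semiring R] [Fintype ι] [DecidableEq ι] {N : ℕ}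
    (f : ι ↪ Fin N) (d : ι → R) :
    padMat f (Matrix.diagonal d) = Matrix.diagonal (Function.extend f d 0) := by
  ext i j
  have hinner : ∀ a : ι, (∑ b, if f a = i ∧ f b = j then Matrix.diagonal d a b else 0) =
      if f a = i ∧ f a = j then d a else 0 := fun a => by
    rw [Finset.sum_eq_single a]
    · simp
    · intro b _ hb
      simp [Matrix.diagonal_apply_ne _ (Ne.symm hb)]
    · simp
  simp only [padMat, hinner]
  by_cases hi : ∃ a, f a = i
  · obtain ⟨a, rfl⟩ := hi
    rw [Finset.sum_eq_single a]
    · simp [Matrix.diagonal_apply, f.injective.extend_apply]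
    · intro b _ hb
      simp [f.injective.ne hb]
    · simp
  · rw [Finset.sum_eq_zero fun a _ => if_neg fun h => hi ⟨a, h.1⟩, Matrix.diagonal_apply,
      Function.extend_apply' _ _ _ hi]
    simp

theorem map_padMat {R R' ι : Type*} [Semiring R] [Semiring R'] [Fintype ι] [DecidableEq ι]
    {N : ℕ} (φ : R →+* R') (f : ι ↪ Fin N) (P : Matrix ι ι R) :
    φ.mapMatrix (padMat f P) = padMat f (φ.mapMatrix P) := by
  ext i j
  simp [padMat, apply_ite φ]

variable {K : Type*} [AddCommGroup K] [Module ℂ K]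

/-- The operator on `K^N` given by a matrix of operators on `K`. -/
def matrixOperator {N : ℕ} :
    Matrix (Fin N) (Fin N) (Module.End ℂ K) →+* Module.End ℂ (Fin N → K) :=
  (endVecRingEquivMatrixEnd (Fin N) ℂ K).symm.toRingHom

theorem matrixOperator_diagonal_apply {N : ℕ} (d : Fin N → Module.End ℂ K) (v : Fin N → K)
    (i : Fin N) : matrixOperator (Matrix.diagonal d) v i = d i (v i) := by
  change ∑ j, Matrix.diagonal d i j (v j) = d i (v i)
  rw [Finset.sum_eq_single i]
  · simp
  · intro j _ hj
    simp [Matrix.diagonal_apply_ne _ (Ne.symm hj)]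
  · simp

/-- The range of a diagonal operator is the product of the ranges of its entries. -/
def rangeDiagonalEquiv {N : ℕ} (d : Fin N → Module.End ℂ K) :
    LinearMap.range (matrixOperator (Matrix.diagonal d)) ≃ₗ[ℂ]
      ((i : Fin N) → LinearMap.range (d i)) where
  toFun w i := ⟨w.1 i, by
    obtain ⟨v, hv⟩ := w.2
    exact ⟨v i, by rw [← hv, matrixOperator_diagonal_apply]⟩⟩
  map_add' _ _ := rfl
  map_smul' _ _ := rfl
  invFun w := ⟨fun i => (w i).1, by
    choose v hv using fun i => (w i).2
    exact ⟨v, funext fun i => by rw [matrixOperator_diagonal_apply, hv]⟩⟩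
  left_inv _ := rfl
  right_inv _ := rfl

theorem finrank_range_units_conj {W : Type*} [AddCommGroup W] [Module ℂ W]
    (U : (Module.End ℂ W)ˣ) (T : Module.End ℂ W) :
    Module.finrank ℂ (LinearMap.range (U.val * T * (U⁻¹).val)) =
      Module.finrank ℂ (LinearMap.range T) := by
  let e : W ≃ₗ[ℂ] W := LinearMap.GeneralLinearGroup.toLinearEquiv U
  have h : LinearMap.range (U.val * T * (U⁻¹).val) =
      (LinearMap.range T).map (e : W →ₗ[ℂ] W) := by
    have hsurj : LinearMap.range (U⁻¹).val = ⊤ :=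
      LinearMap.range_eq_top.2 (LinearMap.GeneralLinearGroup.toLinearEquiv U⁻¹).surjective
    rw [Module.End.mul_eq_comp, LinearMap.range_comp, hsurj, Submodule.map_top,
      Module.End.mul_eq_comp, LinearMap.range_comp]
    rfl
  rw [h]
  exact LinearEquiv.finrank_map_eq e _

theorem finrank_range_eq_of_conj {R : Type*} [Ring R] (φ : R →+* Module.End ℂ K)
    {N : ℕ} {P Q : Matrix (Fin N) (Fin N) R} (U : (Matrix (Fin N) (Fin N) R)ˣ)
    (h : U.val * P * (U⁻¹).val = Q) :
    Module.finrank ℂ (LinearMap.range (matrixOperator (φ.mapMatrix P))) =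
      Module.finrank ℂ (LinearMap.range (matrixOperator (φ.mapMatrix Q))) := by
  let Φ := (matrixOperator (K := K) (N := N)).comp φ.mapMatrix
  have := finrank_range_units_conj (Units.map Φ.toMonoidHom U) (Φ P)
  rw [← h]
  change _ = Module.finrank ℂ (LinearMap.range (Φ (U.val * P * (U⁻¹).val)))
  rw [map_mul, map_mul]
  exact this.symm

theorem finrank_range_padMat_diagonal {ι : Type*} [Fintype ι] [DecidableEq ι] {N : ℕ}
    (f : ι ↪ Fin N) (d : ι → Module.End ℂ K)
    (hd : ∀ a, FiniteDimensional ℂ (LinearMap.range (d a))) :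
    Module.finrank ℂ (LinearMap.range (matrixOperator (padMat f (Matrix.diagonal d)))) =
      ∑ a, Module.finrank ℂ (LinearMap.range (d a)) := by
  have hzero : ∀ i, i ∉ Set.range f → Function.extend f d 0 i = 0 := fun i hi =>
    Function.extend_apply' _ _ _ hi
  have hfin : ∀ i, FiniteDimensional ℂ (LinearMap.range (Function.extend f d 0 i)) := by
    intro i
    by_cases hi : i ∈ Set.range f
    · obtain ⟨a, rfl⟩ := hi
      rw [f.injective.extend_apply]
      exact hd a
    · rw [hzero i hi, LinearMap.range_zero]
      infer_instance
  rw [padMat_diagonal, (rangeDiagonalEquiv _).finrank_eq, Module.finrank_pi_fintype]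
  symm
  refine Fintype.sum_of_injective f f.injective _ _ (fun i hi => ?_) fun a => ?_
  · rw [hzero i hi, LinearMap.range_zero, finrank_bot]
  · rw [f.injective.extend_apply]

theorem finrank_range_padMat_diagonal_eq_zero {ι : Type*} [Fintype ι] [DecidableEq ι] {N : ℕ}
    (f : ι ↪ Fin N) (d : ι → Module.End ℂ K) (a : ι)
    (ha : ¬ FiniteDimensional ℂ (LinearMap.range (d a))) :
    Module.finrank ℂ (LinearMap.range (matrixOperator (padMat f (Matrix.diagonal d)))) = 0 := by
  refine Module.finrank_of_not_finite fun hfin => ha ?_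
  rw [padMat_diagonal] at hfin
  have := Module.Finite.equiv (rangeDiagonalEquiv (Function.extend f d 0))
  have hpi := Module.Finite.of_surjective
    (LinearMap.proj (R := ℂ) (φ := fun i => LinearMap.range (Function.extend f d 0 i)) (f a))
    (Function.surjective_eval _)
  rwa [f.injective.extend_apply] at hpi

end RankOfIdempotents

section AsymptoticIntertwining

open Filter Topology

variable {H K : Type*} [NormedAddCommGroup H] [InnerProductSpace ℂ H]
  [NormedAddCommGroup K] [InnerProductSpace ℂ K]

/-- The isometries `V m` asymptotically intertwine the operators `x` and `y`. -/
def Intertwines (V : ℕ → K →ₗᵢ[ℂ] H) (x : H →L[ℂ] H) (y : K →L[ℂ] K) : Prop :=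
  Tendsto (fun m => x ∘L (V m).toContinuousLinearMap - (V m).toContinuousLinearMap ∘L y)
    atTop (𝓝 0)

namespace Intertwines

variable {V : ℕ → K →ₗᵢ[ℂ] H} {x x' : H →L[ℂ] H} {y y' : K →L[ℂ] K}

theorem of_eq (h : ∀ m v, x (V m v) = V m (y v)) : Intertwines V x y := by
  refine tendsto_const_nhds.congr fun m => ?_
  ext1 v
  simp [h]

theorem add (h : Intertwines V x y) (h' : Intertwines V x' y') :
    Intertwines V (x + x') (y + y') := by
  have := Tendsto.add h h'
  rw [add_zero] at this
  refine this.congr fun m => ?_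
  ext1 v
  simp
  abel

theorem smul_one (c : ℂ) : Intertwines V (c • 1) (c • 1) := of_eq fun m v => by simp

theorem one : Intertwines V 1 1 := of_eq fun _ _ => rfl

theorem zero : Intertwines V 0 0 := of_eq fun m _ => (map_zero (V m)).symm

theorem neg (h : Intertwines V x y) : Intertwines V (-x) (-y) := by
  have := Tendsto.neg h
  rw [neg_zero] at this
  refine this.congr fun m => ?_
  ext1 v
  simp
  abel

theorem sub (h : Intertwines V x y) (h' : Intertwines V x' y') :
    Intertwines V (x - x') (y - y') := by
  rw [sub_eq_add_neg, sub_eq_add_neg]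
  exact h.add h'.neg

theorem mul (h : Intertwines V x y) (h' : Intertwines V x' y') :
    Intertwines V (x * x') (y * y') := by
  have h₁ := ((ContinuousLinearMap.compL ℂ K H H x).continuous.tendsto 0).comp h'
  have h₂ := (((ContinuousLinearMap.compL ℂ K K H).flip y').continuous.tendsto 0).comp h
  have := h₁.add h₂
  rw [map_zero, map_zero, add_zero] at this
  refine this.congr fun m => ?_
  ext1 v
  simp

theorem norm_le (h : Intertwines V x y) : ‖y‖ ≤ ‖x‖ := by
  refine y.opNorm_le_bound (norm_nonneg _) fun v => ?_
  have h₁ : Tendsto (fun m => ‖x‖ * ‖v‖ +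
      ‖x ∘L (V m).toContinuousLinearMap - (V m).toContinuousLinearMap ∘L y‖ * ‖v‖) atTop
      (𝓝 (‖x‖ * ‖v‖ + ‖(0 : K →L[ℂ] H)‖ * ‖v‖)) :=
    (((tendsto_norm (E := K →L[ℂ] H)).comp h).mul_const _).const_add _
  rw [norm_zero, zero_mul, add_zero] at h₁
  refine ge_of_tendsto' h₁ fun m => ?_
  have h₂ := (x ∘L (V m).toContinuousLinearMap -
    (V m).toContinuousLinearMap ∘L y).le_opNorm v
  have h₃ := x.le_opNorm (V m v)
  have h₄ := norm_sub_norm_le (V m (y v)) (x (V m v))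
  rw [norm_sub_rev] at h₄
  simp only [LinearIsometry.norm_map] at h₃ h₄
  simp only [sub_apply, ContinuousLinearMap.comp_apply,
    LinearIsometry.coe_toContinuousLinearMap] at h₂
  linarith

theorem unique (h : Intertwines V x y) (h' : Intertwines V x y') : y = y' := by
  have := (h.sub h').norm_le
  rw [sub_self, norm_zero] at this
  exact sub_eq_zero.1 (norm_le_zero_iff.1 this)

theorem of_tendsto {a : ℕ → H →L[ℂ] H} {b : ℕ → K →L[ℂ] K} (h : ∀ k, Intertwines V (a k) (b k))
    (ha : Tendsto a atTop (𝓝 x)) (hb : Tendsto b atTop (𝓝 y)) : Intertwines V x y := by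
  rw [Intertwines, Metric.tendsto_atTop]
  intro ε hε
  obtain ⟨k, hka, hkb⟩ := ((Metric.tendsto_nhds.1 ha (ε / 3) (by positivity)).and
    (Metric.tendsto_nhds.1 hb (ε / 3) (by positivity))).exists
  obtain ⟨M, hM⟩ := Metric.tendsto_atTop.1 (h k) (ε / 3) (by positivity)
  refine ⟨M, fun m hm => ?_⟩
  have hm := hM m hm
  rw [dist_zero_right] at hm ⊢
  rw [dist_eq_norm] at hka hkb
  have hV : ‖(V m).toContinuousLinearMap‖ ≤ 1 := (V m).norm_toContinuousLinearMap_le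
  have hsplit : x ∘L (V m).toContinuousLinearMap - (V m).toContinuousLinearMap ∘L y =
      (a k ∘L (V m).toContinuousLinearMap - (V m).toContinuousLinearMap ∘L b k) -
      (a k - x) ∘L (V m).toContinuousLinearMap + (V m).toContinuousLinearMap ∘L (b k - y) := by
    ext1 v
    simp
  have h₁ := (a k - x).opNorm_comp_le (V m).toContinuousLinearMap
  have h₂ := (V m).toContinuousLinearMap.opNorm_comp_le (b k - y)
  have h₃ := mul_le_mul_of_nonneg_left hV (norm_nonneg (a k - x))
  have h₄ := mul_le_mul_of_nonneg_right hV (norm_nonneg (b k - y))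
  rw [hsplit]
  refine (norm_add_le _ _).trans_lt ?_
  have := norm_sub_le (a k ∘L (V m).toContinuousLinearMap - (V m).toContinuousLinearMap ∘L b k)
    ((a k - x) ∘L (V m).toContinuousLinearMap)
  linarith

theorem isClosed_setOf_exists [CompleteSpace K] : IsClosed {x | ∃ y, Intertwines V x y} := by
  rw [← isSeqClosed_iff_isClosed]
  intro a x ha hx
  choose b hb using ha
  have hcauchy : CauchySeq b := by
    refine Metric.cauchySeq_iff.2 fun ε hε => ?_
    obtain ⟨M, hM⟩ := Metric.cauchySeq_iff.1 hx.cauchySeq ε hε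
    refine ⟨M, fun m hm k hk => lt_of_le_of_lt ?_ (hM m hm k hk)⟩
    rw [dist_eq_norm, dist_eq_norm]
    exact ((hb m).sub (hb k)).norm_le
  obtain ⟨y, hy⟩ := cauchySeq_tendsto_of_complete hcauchy
  exact ⟨y, of_tendsto hb hx hy⟩

end Intertwines

/-- An isometry whose adjoint has the range of `V m` as an eigenspace with eigenvalue tending to
`1` is asymptotically intertwined with the identity. -/
theorem Intertwines.of_isometry_eigenspace [CompleteSpace H] {V : ℕ → K →ₗᵢ[ℂ] H}
    {x : H →L[ℂ] H} {r : ℕ → ℝ} (hx : ∀ w, ‖x w‖ = ‖w‖) (hV : ∀ m v, star x (V m v) = (r m : ℂ) • V m v)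
    (hr : Tendsto r atTop (𝓝 1)) : Intertwines V x 1 ∧ Intertwines V (star x) 1 := by
  have key : ∀ m v, ‖x (V m v) - V m v‖ ^ 2 = 2 * (1 - r m) * ‖v‖ ^ 2 := by
    intro m v
    rw [norm_sub_sq (𝕜 := ℂ), hx, (V m).norm_map, ← ContinuousLinearMap.adjoint_inner_right,
      ← ContinuousLinearMap.star_eq_adjoint, hV, inner_smul_right, inner_self_eq_norm_sq_to_K,
      (V m).norm_map]
    have : RCLike.re ((r m : ℂ) * (‖v‖ : ℂ) ^ 2) = r m * ‖v‖ ^ 2 := by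
      norm_cast
    erw [this]
    ring
  have hlim : Tendsto (fun m => √(2 * (1 - r m))) atTop (𝓝 0) := by
    have : Tendsto (fun m => √(2 * (1 - r m))) atTop (𝓝 √(2 * (1 - 1))) :=
      ((hr.const_sub 1).const_mul 2).sqrt
    simpa using this
  constructor
  · refine squeeze_zero_norm (fun m => ?_) hlim
    refine ContinuousLinearMap.opNorm_le_bound _ (Real.sqrt_nonneg _) fun v => ?_
    simp only [sub_apply, ContinuousLinearMap.comp_apply,
      LinearIsometry.coe_toContinuousLinearMap, one_apply_eq_self]
    rw [← Real.sqrt_sq (norm_nonneg (x (V m v) - V m v)), key,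
      Real.sqrt_mul' _ (sq_nonneg _), Real.sqrt_sq (norm_nonneg _)]
  · have h₁ : Tendsto (fun m => |r m - 1|) atTop (𝓝 0) := by
      simpa using (hr.sub_const 1).abs
    refine squeeze_zero_norm (fun m => ?_) h₁
    refine ContinuousLinearMap.opNorm_le_bound _ (abs_nonneg _) fun v => ?_
    simp only [sub_apply, ContinuousLinearMap.comp_apply,
      LinearIsometry.coe_toContinuousLinearMap, one_apply_eq_self, hV]
    have : (r m : ℂ) • V m v - V m v = ((r m - 1 : ℝ) : ℂ) • V m v := by
      push_cast
      rw [sub_smul, one_smul]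
    rw [this, norm_smul, (V m).norm_map, Complex.norm_real, Real.norm_eq_abs]

/-- Contractions converging strongly to zero converge in norm after composition with a compact
operator. -/
theorem IsCompactOperator.tendsto_mul_zero {x : H →L[ℂ] H} (hx : IsCompactOperator x)
    {a : ℕ → H →L[ℂ] H} (ha : ∀ m, ‖a m‖ ≤ 1) (hlim : ∀ w, Tendsto (fun m => a m w) atTop (𝓝 0)) :
    Tendsto (fun m => ‖a m * x‖) atTop (𝓝 0) := by
  rw [Metric.tendsto_atTop]
  intro ε hε
  have htb : TotallyBounded (x '' Metric.closedBall 0 1) :=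
    ((hx.isCompact_closure_image_closedBall 1).totallyBounded).subset subset_closure
  obtain ⟨t, ht, hcov⟩ := Metric.totallyBounded_iff.1 htb (ε / 4) (by positivity)
  have hev : ∀ᶠ m in atTop, ∀ w ∈ t, ‖a m w‖ < ε / 4 := by
    refine (eventually_all_finite ht).2 fun w _ => ?_
    have := Metric.tendsto_nhds.1 (hlim w) (ε / 4) (by positivity)
    simpa using this
  obtain ⟨M, hM⟩ := eventually_atTop.1 hev
  refine ⟨M, fun m hm => ?_⟩
  have hle : ‖a m * x‖ ≤ ε / 2 := by
    refine ContinuousLinearMap.opNorm_le_of_unit_norm (by positivity) fun v hv => ?_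
    obtain ⟨w, hw, hd⟩ := Set.mem_iUnion₂.1 (hcov ⟨v, by simp [hv], rfl⟩)
    rw [Metric.mem_ball, dist_eq_norm] at hd
    have h₁ := hM m hm w hw
    have h₂ := (a m).le_of_opNorm_le (ha m) (x v - w)
    have h₃ := norm_add_le (a m (x v - w)) (a m w)
    rw [← map_add, sub_add_cancel] at h₃
    rw [mul_apply_eq_comp]
    linarith
  rw [Real.dist_eq, sub_zero, abs_of_nonneg (norm_nonneg _)]
  linarith

variable [CompleteSpace H]

/-- The closed star-subalgebra of operators which, together with their adjoints, are asymptotically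
intertwined by `V` with operators on `K`. -/
def intertwinedAlgebra (V : ℕ → K →ₗᵢ[ℂ] H) : StarSubalgebra ℂ (H →L[ℂ] H) where
  carrier := {x | (∃ y, Intertwines V x y) ∧ ∃ y, Intertwines V (star x) y}
  mul_mem' := by
    rintro x x' ⟨⟨y, h⟩, z, k⟩ ⟨⟨y', h'⟩, z', k'⟩
    exact ⟨⟨_, h.mul h'⟩, _, by rw [star_mul]; exact k'.mul k⟩
  add_mem' := by
    rintro x x' ⟨⟨y, h⟩, z, k⟩ ⟨⟨y', h'⟩, z', k'⟩
    exact ⟨⟨_, h.add h'⟩, _, by rw [star_add]; exact k.add k'⟩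
  algebraMap_mem' c := by
    rw [Set.mem_ofPred_eq, Algebra.algebraMap_eq_smul_one, star_smul, star_one]
    exact ⟨⟨_, .smul_one c⟩, _, .smul_one (star c)⟩
  star_mem' := by
    rintro x ⟨h, k⟩
    exact ⟨k, by rwa [star_star]⟩

theorem isClosed_intertwinedAlgebra [CompleteSpace K] (V : ℕ → K →ₗᵢ[ℂ] H) :
    IsClosed (intertwinedAlgebra V : Set (H →L[ℂ] H)) :=
  Intertwines.isClosed_setOf_exists.inter
    (Intertwines.isClosed_setOf_exists.preimage continuous_star)

/-- The operator on `K` asymptotically intertwined with `x`. -/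
def intertwinedLimit {V : ℕ → K →ₗᵢ[ℂ] H} {x : H →L[ℂ] H} (hx : x ∈ intertwinedAlgebra V) :
    K →L[ℂ] K := hx.1.choose

theorem intertwines_intertwinedLimit {V : ℕ → K →ₗᵢ[ℂ] H} {x : H →L[ℂ] H}
    (hx : x ∈ intertwinedAlgebra V) : Intertwines V x (intertwinedLimit hx) := hx.1.choose_spec

/-- The representation on `K` of an algebra of operators asymptotically intertwined by `V`. -/
def intertwinedRep (V : ℕ → K →ₗᵢ[ℂ] H) (T : StarSubalgebra ℂ (H →L[ℂ] H))
    (hT : T ≤ intertwinedAlgebra V) : T →+* (K →L[ℂ] K) where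
  toFun x := intertwinedLimit (hT x.2)
  map_one' := (intertwines_intertwinedLimit _).unique .one
  map_mul' x x' := (intertwines_intertwinedLimit _).unique
    ((intertwines_intertwinedLimit (hT x.2)).mul (intertwines_intertwinedLimit (hT x'.2)))
  map_zero' := (intertwines_intertwinedLimit _).unique .zero
  map_add' x x' := (intertwines_intertwinedLimit _).unique
    ((intertwines_intertwinedLimit (hT x.2)).add (intertwines_intertwinedLimit (hT x'.2)))

theorem intertwinedRep_eq {V : ℕ → K →ₗᵢ[ℂ] H} {T : StarSubalgebra ℂ (H →L[ℂ] H)}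
    (hT : T ≤ intertwinedAlgebra V) {x : T} {y : K →L[ℂ] K} (h : Intertwines V x y) :
    intertwinedRep V T hT x = y :=
  (intertwines_intertwinedLimit (hT x.2)).unique h

end AsymptoticIntertwining

section SquareSummable

open Filter Topology

/-- The Hilbert space `ℓ²(ι)`. -/
abbrev EllTwo (ι : Type*) : Type _ := lp (fun _ : ι => ℂ) 2

variable {ι α β γ : Type*}

namespace EllTwo

/-- The coordinate functional at `i`. -/
def coord (i : ι) : EllTwo ι →L[ℂ] ℂ := lp.evalCLM ℂ (fun _ : ι => ℂ) 2 i

theorem coord_apply (i : ι) (w : EllTwo ι) : coord i w = w i := rfl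

variable [DecidableEq ι]

/-- The standard basis vector of `ℓ²(ι)` at `i`. -/
def basisVec (i : ι) : EllTwo ι := lp.single 2 i 1

theorem basisVec_apply (i j : ι) : basisVec i j = if j = i then 1 else 0 := by
  rw [basisVec, lp.single_apply, Pi.single_apply]

theorem inner_basisVec (i : ι) (w : EllTwo ι) : inner ℂ (basisVec i) w = w i := by
  rw [basisVec, lp.inner_single_left]
  simp

theorem orthonormal_basisVec : Orthonormal ℂ (basisVec : ι → EllTwo ι) := by
  rw [orthonormal_iff_ite]
  intro i j
  rw [inner_basisVec, basisVec_apply]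

theorem clm_ext {F : Type*} [AddCommMonoid F] [Module ℂ F] [TopologicalSpace F] [T2Space F]
    {f g : EllTwo ι →L[ℂ] F} (h : ∀ i, f (basisVec i) = g (basisVec i)) : f = g :=
  lp.ext_continuousLinearMap (by simp) fun i => ContinuousLinearMap.ext_ring (h i)

/-- The coefficients of `T w` are determined by the images of the basis vectors. -/
theorem apply_eq_of_forall_basisVec (T : EllTwo ι →L[ℂ] EllTwo γ) (c : γ)
    (φ : EllTwo ι →L[ℂ] ℂ) (h : ∀ i, T (basisVec i) c = φ (basisVec i)) (w : EllTwo ι) :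
    T w c = φ w :=
  DFunLike.congr_fun (clm_ext (f := lp.evalCLM ℂ (fun _ : γ => ℂ) 2 c ∘L T) (g := φ) h) w

theorem adjoint_apply (T : EllTwo ι →L[ℂ] EllTwo γ) (w : EllTwo γ) (i : ι) :
    T.adjoint w i = inner ℂ (T (basisVec i)) w := by
  rw [← inner_basisVec, ContinuousLinearMap.adjoint_inner_right]

/-- The isometry sending the standard basis to an orthonormal family. -/
def isometryOfOrthonormal {E : Type*} [NormedAddCommGroup E] [InnerProductSpace ℂ E]
    [CompleteSpace E] {v : ι → E} (hv : Orthonormal ℂ v) : EllTwo ι →ₗᵢ[ℂ] E :=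
  hv.orthogonalFamily.linearIsometry

theorem isometryOfOrthonormal_basisVec {E : Type*} [NormedAddCommGroup E] [InnerProductSpace ℂ E]
    [CompleteSpace E] {v : ι → E} (hv : Orthonormal ℂ v) (i : ι) :
    isometryOfOrthonormal hv (basisVec i) = v i := by
  rw [isometryOfOrthonormal, basisVec, OrthogonalFamily.linearIsometry_apply_single]
  simp

variable [DecidableEq α] [DecidableEq β] [DecidableEq γ]

/-- The embedding of `ℓ²(α)` into `ℓ²(γ) ≃ ℓ²(α × β)` as the fiber over `b`. -/
def fiberEmbedding (e : γ ≃ α × β) (b : β) : EllTwo α →ₗᵢ[ℂ] EllTwo γ :=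
  isometryOfOrthonormal (v := fun a => basisVec (e.symm (a, b)))
    (orthonormal_basisVec.comp _ fun _ _ h => (Prod.ext_iff.1 (e.symm.injective h)).1)

theorem fiberEmbedding_apply (e : γ ≃ α × β) (b : β) (w : EllTwo α) (c : γ) :
    fiberEmbedding e b w c = if (e c).2 = b then w (e c).1 else 0 := by
  have := apply_eq_of_forall_basisVec (fiberEmbedding e b).toContinuousLinearMap c
    (if (e c).2 = b then coord (e c).1 else 0) (fun a => by
      rw [LinearIsometry.coe_toContinuousLinearMap, fiberEmbedding,
        isometryOfOrthonormal_basisVec, basisVec_apply]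
      simp only [Equiv.eq_symm_apply, Prod.ext_iff]
      split_ifs with h₁ h₂ h₂ <;> simp_all [coord_apply, basisVec_apply]) w
  rw [LinearIsometry.coe_toContinuousLinearMap] at this
  rw [this]
  split_ifs <;> rfl

theorem orthonormal_fiberEmbedding (e : γ ≃ α × β) {ξ : EllTwo α} (hξ : ‖ξ‖ = 1) :
    Orthonormal ℂ fun b => fiberEmbedding e b ξ := by
  refine ⟨fun b => by rw [LinearIsometry.norm_map, hξ], fun b b' hb => ?_⟩
  change inner ℂ (fiberEmbedding e b ξ) (fiberEmbedding e b' ξ) = 0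
  rw [lp.inner_eq_tsum]
  refine (tsum_congr fun c => ?_).trans tsum_zero
  rw [fiberEmbedding_apply, fiberEmbedding_apply]
  split_ifs with h h'
  · exact absurd (h.symm.trans h') hb
  all_goals simp

/-- The isometry `v ↦ ξ ⊗ v` for a unit vector `ξ`. -/
def tensorLeft (e : γ ≃ α × β) {ξ : EllTwo α} (hξ : ‖ξ‖ = 1) : EllTwo β →ₗᵢ[ℂ] EllTwo γ :=
  isometryOfOrthonormal (orthonormal_fiberEmbedding e hξ)

theorem tensorLeft_apply (e : γ ≃ α × β) {ξ : EllTwo α} (hξ : ‖ξ‖ = 1) (v : EllTwo β) (c : γ) :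
    tensorLeft e hξ v c = ξ (e c).1 * v (e c).2 :=
  apply_eq_of_forall_basisVec (tensorLeft e hξ).toContinuousLinearMap c
    (ξ (e c).1 • coord (e c).2) (fun b => by
      rw [LinearIsometry.coe_toContinuousLinearMap, tensorLeft, isometryOfOrthonormal_basisVec,
        fiberEmbedding_apply]
      simp [coord_apply, basisVec_apply]) v

theorem norm_basisVec (i : ι) : ‖(basisVec i : EllTwo ι)‖ = 1 := orthonormal_basisVec.1 i

/-- The compression of an operator to the fiber over `a`. -/
def compression (e : γ ≃ α × β) (a : α) (T : EllTwo γ →L[ℂ] EllTwo γ) :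
    EllTwo β →L[ℂ] EllTwo β :=
  (tensorLeft e (norm_basisVec a)).toContinuousLinearMap.adjoint ∘L T ∘L
    (tensorLeft e (norm_basisVec a)).toContinuousLinearMap

theorem compression_apply (e : γ ≃ α × β) (a : α) (T : EllTwo γ →L[ℂ] EllTwo γ) (v : EllTwo β)
    (b : β) : compression e a T v b = T (tensorLeft e (norm_basisVec a) v) (e.symm (a, b)) := by
  have h : tensorLeft e (norm_basisVec a) (basisVec b) = basisVec (e.symm (a, b)) := by
    ext c
    rw [tensorLeft_apply, basisVec_apply, basisVec_apply, basisVec_apply]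
    simp only [Equiv.eq_symm_apply, Prod.ext_iff]
    split_ifs <;> simp_all
  rw [compression, ContinuousLinearMap.comp_apply, adjoint_apply,
    LinearIsometry.coe_toContinuousLinearMap, h, inner_basisVec]
  rfl

/-- Contractions that tend to zero on the standard basis tend to zero strongly. -/
theorem tendsto_zero_of_basisVec {a : ℕ → EllTwo ι →L[ℂ] EllTwo ι} (ha : ∀ k, ‖a k‖ ≤ 1)
    (h : ∀ i, Tendsto (fun k => a k (basisVec i)) atTop (𝓝 0)) (w : EllTwo ι) :
    Tendsto (fun k => a k w) atTop (𝓝 0) := by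
  rw [Metric.tendsto_atTop]
  intro ε hε
  obtain ⟨s, hs⟩ := (Metric.tendsto_nhds.1 (lp.hasSum_single (by simp) w) (ε / 2)
    (by positivity)).exists
  set w' := ∑ i ∈ s, lp.single 2 i (w i) with hw'
  have hlim : Tendsto (fun k => a k w') atTop (𝓝 0) := by
    have hsum : ∀ k, a k w' = ∑ i ∈ s, w i • a k (basisVec i) := fun k => by
      rw [hw', map_sum]
      refine Finset.sum_congr rfl fun i _ => ?_
      rw [← map_smul, basisVec, ← lp.single_smul, smul_eq_mul, mul_one]
    simp only [hsum]
    rw [← Finset.sum_const_zero (s := s)]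
    refine tendsto_finsetSum _ fun i _ => ?_
    simpa using (h i).const_smul (w i)
  obtain ⟨M, hM⟩ := Metric.tendsto_atTop.1 hlim (ε / 2) (by positivity)
  refine ⟨M, fun k hk => ?_⟩
  have h₁ := hM k hk
  have h₂ := (a k).le_of_opNorm_le (ha k) (w - w')
  rw [dist_comm, dist_eq_norm] at hs
  rw [dist_zero_right] at h₁ ⊢
  have h₃ := norm_add_le (a k (w - w')) (a k w')
  rw [← map_add, sub_add_cancel] at h₃
  linarith

end EllTwo

end SquareSummable

section GeometricVector

open Filter Topology

variable {ι : Type*} [Fintype ι]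

theorem summable_pow_sum {r : ℝ} (h₀ : 0 ≤ r) (h₁ : r < 1) :
    Summable fun k : ι → ℕ => r ^ ∑ i, k i := by
  classical
  refine summable_of_sum_le (c := ((1 - r)⁻¹) ^ Fintype.card ι) (fun k => pow_nonneg h₀ _)
    fun s => ?_
  let M := s.sup fun k => ∑ i, k i
  have hsub : s ⊆ Fintype.piFinset fun _ : ι => Finset.range (M + 1) := fun k hk => by
    refine Fintype.mem_piFinset.2 fun i => Finset.mem_range_succ_iff.2 ?_
    exact (Finset.single_le_sum (fun j _ => Nat.zero_le (k j)) (Finset.mem_univ i)).trans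
      (Finset.le_sup (f := fun k : ι → ℕ => ∑ i, k i) hk)
  calc ∑ k ∈ s, r ^ ∑ i, k i
      ≤ ∑ k ∈ Fintype.piFinset fun _ : ι => Finset.range (M + 1), r ^ ∑ i, k i :=
        Finset.sum_le_sum_of_subset_of_nonneg hsub fun _ _ _ => pow_nonneg h₀ _
    _ = ∏ _i : ι, ∑ j ∈ Finset.range (M + 1), r ^ j := by
        rw [Finset.prod_univ_sum]
        exact Finset.sum_congr rfl fun k _ => (Finset.prod_pow_eq_pow_sum _ _ _).symm
    _ ≤ ∏ _i : ι, (1 - r)⁻¹ := by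
        refine Finset.prod_le_prod (fun _ _ => Finset.sum_nonneg fun _ _ => pow_nonneg h₀ _)
          fun _ _ => ?_
        rw [← tsum_geometric_of_lt_one h₀ h₁]
        exact (summable_geometric_of_lt_one h₀ h₁).sum_le_tsum _ fun _ _ => pow_nonneg h₀ _
    _ = _ := by simp

theorem exists_unit_eigenvector [DecidableEq ι] {r : ℝ} (h₀ : 0 ≤ r) (h₁ : r < 1) :
    ∃ ξ : EllTwo (ι → ℕ), ‖ξ‖ = 1 ∧
      ∀ k i, ξ (Function.update k i (k i + 1)) = (r : ℂ) * ξ k := by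
  have hmem : Memℓp (fun k : ι → ℕ => (r : ℂ) ^ ∑ i, k i) 2 := by
    refine memℓp_gen ?_
    have := summable_pow_sum (ι := ι) (r := r ^ 2) (by positivity) (by nlinarith)
    refine this.congr fun k => ?_
    simp [← pow_mul, mul_comm, abs_of_nonneg h₀]
  let g : EllTwo (ι → ℕ) := ⟨_, hmem⟩
  have hg : g ≠ 0 := fun h => by
    have : g 0 = 0 := by rw [h]; rfl
    have h' : g 0 = (r : ℂ) ^ ∑ i : ι, (0 : ι → ℕ) i := rfl
    rw [h'] at this
    simp at this
  refine ⟨(‖g‖⁻¹ : ℂ) • g, ?_, fun k i => ?_⟩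
  · rw [norm_smul, norm_inv, Complex.norm_real, norm_norm,
      inv_mul_cancel₀ (norm_ne_zero_iff.2 hg)]
  · have hsum : ∑ j, Function.update k i (k i + 1) j = (∑ j, k j) + 1 := by
      rw [Finset.sum_update_of_mem (Finset.mem_univ i),
        ← Finset.add_sum_erase _ _ (Finset.mem_univ i), Finset.sdiff_singleton_eq_erase]
      ring
    change (‖g‖⁻¹ : ℂ) * (r : ℂ) ^ (∑ j, Function.update k i (k i + 1) j) =
      r * ((‖g‖⁻¹ : ℂ) * (r : ℂ) ^ (∑ j, k j))
    rw [hsum, pow_succ]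
    ring

end GeometricVector

section CoordinateShift

open Filter Topology EllTwo

variable {ι : Type*} [Fintype ι] [DecidableEq ι]

/-- The coordinate shift on `ℓ²(ℕ^ι)`. -/
def coordShift (i : ι) : EllTwo (ι → ℕ) →ₗᵢ[ℂ] EllTwo (ι → ℕ) :=
  isometryOfOrthonormal (v := fun z : ι → ℕ => basisVec (Function.update z i (z i + 1)))
    (orthonormal_basisVec.comp _ fun z z' h => by
      funext j
      have hj := congrFun h j
      by_cases hji : j = i
      · subst hji
        simpa using hj
      · simpa [hji] using hj)

theorem coordShift_basisVec (i : ι) (z : ι → ℕ) :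
    coordShift i (basisVec z) = basisVec (Function.update z i (z i + 1)) :=
  isometryOfOrthonormal_basisVec _ z

theorem coordShift_apply (i : ι) (w : EllTwo (ι → ℕ)) (z : ι → ℕ) :
    coordShift i w z = if z i = 0 then 0 else w (Function.update z i (z i - 1)) := by
  have := apply_eq_of_forall_basisVec (coordShift i).toContinuousLinearMap z
    (if z i = 0 then 0 else coord (Function.update z i (z i - 1))) (fun u => by
      rw [LinearIsometry.coe_toContinuousLinearMap, coordShift_basisVec, basisVec_apply]
      split_ifs with h₁ h₂ h₂
      · rw [h₁] at h₂
        simp at h₂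
      · rw [coord_apply, basisVec_apply, if_pos]
        rw [h₁]
        simp
      · rfl
      · rw [coord_apply, basisVec_apply, if_neg]
        rintro rfl
        refine h₁ ?_
        simp [Nat.sub_add_cancel (Nat.pos_of_ne_zero h₂)]) w
  rw [LinearIsometry.coe_toContinuousLinearMap] at this
  rw [this]
  split_ifs <;> rfl

theorem star_coordShift_apply (i : ι) (w : EllTwo (ι → ℕ)) (z : ι → ℕ) :
    star (coordShift i).toContinuousLinearMap w z = w (Function.update z i (z i + 1)) := by
  rw [ContinuousLinearMap.star_eq_adjoint, adjoint_apply,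
    LinearIsometry.coe_toContinuousLinearMap, coordShift_basisVec, inner_basisVec]

theorem star_coordShift_pow_apply (i : ι) (k : ℕ) (w : EllTwo (ι → ℕ)) (z : ι → ℕ) :
    (star (coordShift i).toContinuousLinearMap ^ k) w z = w (Function.update z i (z i + k)) := by
  induction k generalizing z with
  | zero => simp
  | succ k ih =>
    rw [pow_succ', mul_apply_eq_comp, star_coordShift_apply, ih]
    simp [add_assoc, add_comm 1 k]

theorem norm_star_coordShift_pow_le (i : ι) (k : ℕ) :
    ‖star (coordShift i).toContinuousLinearMap ^ k‖ ≤ 1 := by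
  induction k with
  | zero => exact ContinuousLinearMap.norm_id_le
  | succ k ih =>
    rw [pow_succ]
    refine (norm_mul_le _ _).trans (mul_le_one₀ ih (norm_nonneg _) ?_)
    rw [ContinuousLinearMap.star_eq_adjoint, LinearIsometryEquiv.norm_map]
    exact (coordShift i).norm_toContinuousLinearMap_le

theorem tendsto_star_coordShift_pow (i : ι) (w : EllTwo (ι → ℕ)) :
    Tendsto (fun k => (star (coordShift i).toContinuousLinearMap ^ k) w) atTop (𝓝 0) := by
  refine tendsto_zero_of_basisVec (norm_star_coordShift_pow_le i) (fun z => ?_) w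
  refine tendsto_const_nhds.congr' ?_
  filter_upwards [eventually_gt_atTop (z i)] with k hk
  ext u
  rw [star_coordShift_pow_apply, basisVec_apply, if_neg]
  · rfl
  · intro h
    have := congrFun h i
    simp at this
    omega

end CoordinateShift

section TorusCharacters

open Filter Topology EllTwo

variable {n : ℕ}

theorem delta_eq_basisVec (z : Fin n → ℕ) : delta z = basisVec z := rfl

theorem IsShift.eq_coordShift {i : Fin n} {T : Hn n →L[ℂ] Hn n} (h : IsShift i T) :
    T = (coordShift i).toContinuousLinearMap :=
  clm_ext fun z => (h z).trans (coordShift_basisVec i z).symm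

open scoped Classical in
theorem IsQProj.apply {S : Finset (Fin n)} {Q : Hn n →L[ℂ] Hn n} (h : IsQProj S Q) (w : Hn n)
    (z : Fin n → ℕ) : Q w z = if ∀ i ∉ S, z i = 0 then w z else 0 := by
  have := apply_eq_of_forall_basisVec Q z (if ∀ i ∉ S, z i = 0 then coord z else 0) (fun u => by
    rw [← delta_eq_basisVec, h u, delta_eq_basisVec]
    by_cases huz : z = u
    · subst huz
      split_ifs <;> rfl
    · have hne : (basisVec u : Hn n) z = 0 := by rw [basisVec_apply, if_neg huz]
      split_ifs <;> simp [coord_apply, hne]) w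
  rw [this]
  split_ifs <;> rfl

variable (S : Finset (Fin n))

/-- The space `ℓ²(ℕ^{Sᶜ})`. -/
abbrev ComplSpace : Type := EllTwo ({i // i ∉ S} → ℕ)

/-- Splitting of `ℕ^n` as `ℕ^S × ℕ^{Sᶜ}`. -/
def splitCoords : (Fin n → ℕ) ≃ ({i // i ∈ S} → ℕ) × ({i // i ∉ S} → ℕ) :=
  Equiv.piEquivPiSubtypeProd (· ∈ S) fun _ => ℕ

/-- The eigenvalues `(m + 1) / (m + 2)` used to approximate the character at `1`. -/
def ratio (m : ℕ) : ℝ := 1 - 1 / ((m + 1 : ℕ) + 1 : ℝ)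

theorem ratio_nonneg (m : ℕ) : 0 ≤ ratio m := by
  rw [ratio, sub_nonneg, div_le_one (by positivity)]
  push_cast
  linarith [(Nat.cast_nonneg m : (0 : ℝ) ≤ m)]

theorem ratio_lt_one (m : ℕ) : ratio m < 1 := sub_lt_self _ (by positivity)

theorem tendsto_ratio : Tendsto ratio atTop (𝓝 1) := by
  have := ((tendsto_add_atTop_iff_nat 1).2
    (tendsto_one_div_add_atTop_nhds_zero_nat (𝕜 := ℝ))).const_sub 1
  rwa [sub_zero] at this

/-- A unit vector of `ℓ²(ℕ^S)` which is a joint eigenvector of the backward shifts. -/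
def eigenvector (m : ℕ) : EllTwo ({i // i ∈ S} → ℕ) :=
  (exists_unit_eigenvector (ratio_nonneg m) (ratio_lt_one m)).choose

theorem norm_eigenvector (m : ℕ) : ‖eigenvector S m‖ = 1 :=
  (exists_unit_eigenvector (ratio_nonneg m) (ratio_lt_one m)).choose_spec.1

theorem eigenvector_update (m : ℕ) (k : {i // i ∈ S} → ℕ) (i : {i // i ∈ S}) :
    eigenvector S m (Function.update k i (k i + 1)) = (ratio m : ℂ) * eigenvector S m k :=
  (exists_unit_eigenvector (ratio_nonneg m) (ratio_lt_one m)).choose_spec.2 k i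

/-- The isometries `v ↦ ξ_m ⊗ v` given by joint eigenvectors `ξ_m` of the backward shifts. -/
def eigenIsometry (m : ℕ) : ComplSpace S →ₗᵢ[ℂ] Hn n :=
  tensorLeft (splitCoords S) (norm_eigenvector S m)

theorem eigenIsometry_apply (m : ℕ) (v : ComplSpace S) (z : Fin n → ℕ) :
    eigenIsometry S m v z = eigenvector S m (fun i => z i) * v (fun i => z i) :=
  tensorLeft_apply _ _ v z

variable {S}

theorem restrict_update_of_mem {p : Fin n → Prop} {i : Fin n} (hi : p i) (z : Fin n → ℕ) (c : ℕ) :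
    (fun j : Subtype p => Function.update z i c j) =
      Function.update (fun j : Subtype p => z j) ⟨i, hi⟩ c :=
  Function.update_comp_eq_of_injective z Subtype.val_injective ⟨i, hi⟩ c

theorem restrict_update_of_notMem {p : Fin n → Prop} {i : Fin n} (hi : ¬ p i) (z : Fin n → ℕ)
    (c : ℕ) : (fun j : Subtype p => Function.update z i c j) = fun j : Subtype p => z j :=
  funext fun j => Function.update_of_ne (fun h : j.1 = i => hi (h ▸ j.2)) _ _

theorem intertwines_coordShift_of_mem {i : Fin n} (hi : i ∈ S) :
    Intertwines (eigenIsometry S) (coordShift i).toContinuousLinearMap 1 ∧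
      Intertwines (eigenIsometry S) (star (coordShift i).toContinuousLinearMap) 1 := by
  refine Intertwines.of_isometry_eigenspace (coordShift i).norm_map (fun m v => ?_) tendsto_ratio
  ext z
  rw [star_coordShift_apply, eigenIsometry_apply, restrict_update_of_mem hi,
    restrict_update_of_notMem (p := fun i => i ∉ S) (not_not.2 hi)]
  have := eigenvector_update S m (fun j => z j) ⟨i, hi⟩
  dsimp only at this
  rw [this, mul_assoc, ← eigenIsometry_apply]
  rfl

theorem intertwines_coordShift_of_notMem {i : Fin n} (hi : i ∉ S) :
    Intertwines (eigenIsometry S) (coordShift i).toContinuousLinearMap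
        (coordShift ⟨i, hi⟩).toContinuousLinearMap ∧
      Intertwines (eigenIsometry S) (star (coordShift i).toContinuousLinearMap)
        (star (coordShift ⟨i, hi⟩).toContinuousLinearMap) := by
  constructor
  · refine .of_eq fun m v => ?_
    ext z
    rw [LinearIsometry.coe_toContinuousLinearMap, LinearIsometry.coe_toContinuousLinearMap,
      coordShift_apply, eigenIsometry_apply, eigenIsometry_apply, coordShift_apply,
      restrict_update_of_notMem hi, restrict_update_of_mem (p := fun i => i ∉ S) hi]
    split_ifs <;> simp
  · refine .of_eq fun m v => ?_
    ext z
    rw [star_coordShift_apply, eigenIsometry_apply, eigenIsometry_apply, star_coordShift_apply,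
      restrict_update_of_notMem hi, restrict_update_of_mem (p := fun i => i ∉ S) hi]

theorem Toeplitz_le_intertwinedAlgebra (S : Finset (Fin n)) :
    Toeplitz n ≤ intertwinedAlgebra (eigenIsometry S) := by
  refine StarSubalgebra.topologicalClosure_minimal (StarAlgebra.adjoin_le ?_)
    (isClosed_intertwinedAlgebra _)
  rintro T ⟨i, hT⟩
  rw [hT.eq_coordShift]
  by_cases hi : i ∈ S
  · exact ⟨⟨_, (intertwines_coordShift_of_mem hi).1⟩, _, (intertwines_coordShift_of_mem hi).2⟩
  · exact ⟨⟨_, (intertwines_coordShift_of_notMem hi).1⟩, _,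
      (intertwines_coordShift_of_notMem hi).2⟩

/-- The representation of the Toeplitz algebra on `ℓ²(ℕ^{Sᶜ})` sending the shifts in the
directions of `S` to the identity. -/
def toeplitzRep (S : Finset (Fin n)) : Toeplitz n →+* (ComplSpace S →L[ℂ] ComplSpace S) :=
  intertwinedRep (eigenIsometry S) (Toeplitz n) (Toeplitz_le_intertwinedAlgebra S)

theorem toeplitzRep_eq {x : Toeplitz n} {y : ComplSpace S →L[ℂ] ComplSpace S}
    (h : Intertwines (eigenIsometry S) (x : Hn n →L[ℂ] Hn n) y) : toeplitzRep S x = y :=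
  intertwinedRep_eq _ h

theorem intertwines_toeplitzRep (x : Toeplitz n) :
    Intertwines (eigenIsometry S) (x : Hn n →L[ℂ] Hn n) (toeplitzRep S x) :=
  intertwines_intertwinedLimit (Toeplitz_le_intertwinedAlgebra S x.2)

theorem toeplitzRep_eq_zero_of_isCompactOperator (hS : S.Nonempty) {x : Toeplitz n}
    (hx : IsCompactOperator (x : Hn n →L[ℂ] Hn n)) : toeplitzRep S x = 0 := by
  obtain ⟨i, hi⟩ := hS
  have hpow : ∀ k : ℕ, Intertwines (eigenIsometry S)
      (star (coordShift i).toContinuousLinearMap ^ k) 1 := by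
    intro k
    induction k with
    | zero => exact .one
    | succ k ih =>
      rw [pow_succ, ← mul_one (1 : ComplSpace S →L[ℂ] ComplSpace S)]
      exact ih.mul (intertwines_coordShift_of_mem hi).2
  have hle := ge_of_tendsto' (hx.tendsto_mul_zero (norm_star_coordShift_pow_le i)
    (tendsto_star_coordShift_pow i)) fun k => ((hpow k).mul (intertwines_toeplitzRep x)).norm_le
  rw [one_mul] at hle
  exact norm_le_zero_iff.1 hle

/-- The representation of the quantum sphere algebra on `ℓ²(ℕ^{Sᶜ})` induced by `toeplitzRep`. -/
def sphereRep (hS : S.Nonempty) : QuantumSphere n →+* Module.End ℂ (ComplSpace S) :=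
  ContinuousLinearMap.toLinearMapRingHom.comp
    ((compactIdeal n).ringCon.lift (toeplitzRep S) fun x y h => by
      rw [TwoSidedIdeal.rel_iff, compactIdeal, TwoSidedIdeal.mem_mk'] at h
      have := toeplitzRep_eq_zero_of_isCompactOperator hS h
      rwa [map_sub, sub_eq_zero] at this)

theorem sphereRep_toSphere (hS : S.Nonempty) (x : Toeplitz n) :
    sphereRep hS (toSphere n x) = (toeplitzRep S x : ComplSpace S →ₗ[ℂ] ComplSpace S) := rfl

theorem sphereRep_proj_eq_zero (hS : S.Nonempty) {S' : Finset (Fin n)} (h : ¬ S ⊆ S')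
    {Q : Hn n →L[ℂ] Hn n} (hQ : IsQProj S' Q) (hmem : Q ∈ Toeplitz n) :
    sphereRep hS (toSphere n ⟨Q, hmem⟩) = 0 := by
  obtain ⟨i, hi, hi'⟩ := Finset.not_subset.1 h
  have hzero : Q * (coordShift i).toContinuousLinearMap = 0 := by
    refine clm_ext fun z => ?_
    rw [mul_apply_eq_comp, LinearIsometry.coe_toContinuousLinearMap, coordShift_basisVec,
      ← delta_eq_basisVec, hQ, if_neg]
    · rfl
    · intro hz
      simpa using hz i hi'
  have hint := (intertwines_toeplitzRep (S := S) ⟨Q, hmem⟩).mul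
    (intertwines_coordShift_of_mem hi).1
  rw [mul_one, hzero] at hint
  rw [sphereRep_toSphere, hint.unique .zero]
  rfl

open scoped Classical in
theorem sphereRep_proj_apply (hS : S.Nonempty) {S' : Finset (Fin n)} (h : S ⊆ S')
    {Q : Hn n →L[ℂ] Hn n} (hQ : IsQProj S' Q) (hmem : Q ∈ Toeplitz n) (v : ComplSpace S)
    (u : {i // i ∉ S} → ℕ) :
    sphereRep hS (toSphere n ⟨Q, hmem⟩) v u =
      if ∀ i : {i // i ∉ S}, i.1 ∉ S' → u i = 0 then v u else 0 := by
  have hcond : ∀ z : Fin n → ℕ, (∀ i ∉ S', z i = 0) ↔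
      ∀ i : {i // i ∉ S}, i.1 ∉ S' → z i = 0 := fun z =>
    ⟨fun hz i => hz i, fun hz i hi => hz ⟨i, fun hiS => hi (h hiS)⟩ hi⟩
  have hcomp : ∀ v u, compression (splitCoords S) 0 Q v u =
      if ∀ i : {i // i ∉ S}, i.1 ∉ S' → u i = 0 then v u else 0 := by
    intro v u
    have hu : ∀ i : {i // i ∉ S}, (splitCoords S).symm (0, u) i = u i := fun i => by
      have := (splitCoords S).apply_symm_apply (0, u)
      exact congrFun (congrArg Prod.snd this) i
    rw [compression_apply, hQ.apply, tensorLeft_apply, Equiv.apply_symm_apply, basisVec_apply]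
    simp only [hcond, hu, if_true, one_mul]
  have hint : Intertwines (eigenIsometry S) Q (compression (splitCoords S) 0 Q) := by
    refine .of_eq fun m v => ?_
    ext z
    rw [hQ.apply, eigenIsometry_apply, eigenIsometry_apply, hcomp]
    simp only [hcond]
    split_ifs <;> simp
  rw [sphereRep_toSphere, toeplitzRep_eq (x := ⟨Q, hmem⟩) hint]
  exact hcomp v u

theorem range_sphereRep_proj_self (hS : S.Nonempty) {Q : Hn n →L[ℂ] Hn n} (hQ : IsQProj S Q)
    (hmem : Q ∈ Toeplitz n) :
    LinearMap.range (sphereRep hS (toSphere n ⟨Q, hmem⟩)) =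
      Submodule.span ℂ {(basisVec 0 : ComplSpace S)} := by
  have hval : ∀ v, sphereRep hS (toSphere n ⟨Q, hmem⟩) v =
      v 0 • (basisVec 0 : ComplSpace S) := fun v => by
    ext u
    rw [sphereRep_proj_apply hS subset_rfl hQ, lp.coeFn_smul, Pi.smul_apply, basisVec_apply]
    have hiff : (∀ i : {i // i ∉ S}, i.1 ∉ S → u i = 0) ↔ u = 0 :=
      ⟨fun h => funext fun i => h i i.2, fun h i _ => by rw [h]; rfl⟩
    simp only [hiff]
    split_ifs with h <;> simp [h]
  refine le_antisymm ?_ ?_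
  · rintro _ ⟨v, rfl⟩
    rw [hval]
    exact Submodule.smul_mem _ _ (Submodule.mem_span_singleton_self _)
  · rw [Submodule.span_singleton_le_iff_mem]
    exact ⟨basisVec 0, by rw [hval, basisVec_apply, if_pos rfl, one_smul]⟩

theorem not_finiteDimensional_range_sphereRep_proj (hS : S.Nonempty) {S' : Finset (Fin n)}
    (h : S ⊂ S') {Q : Hn n →L[ℂ] Hn n} (hQ : IsQProj S' Q) (hmem : Q ∈ Toeplitz n) :
    ¬ FiniteDimensional ℂ (LinearMap.range (sphereRep hS (toSphere n ⟨Q, hmem⟩))) := by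
  intro hfin
  obtain ⟨j, hj', hj⟩ := Finset.exists_of_ssubset h
  let z : ℕ → {i // i ∉ S} → ℕ := fun k => Pi.single ⟨j, hj⟩ k
  have hz : Function.Injective z := fun a b hab => by
    simpa [z] using congrFun hab ⟨j, hj⟩
  have hrange : ∀ k, (basisVec (z k) : ComplSpace S) ∈
      LinearMap.range (sphereRep hS (toSphere n ⟨Q, hmem⟩)) := fun k => by
    refine ⟨basisVec (z k), ?_⟩
    ext u
    rw [sphereRep_proj_apply hS h.subset hQ, ite_eq_left_iff]
    intro hu
    rw [basisVec_apply, if_neg]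
    rintro rfl
    refine hu fun i hi => Pi.single_eq_of_ne (fun hij => hi ?_) _
    rw [hij]
    exact hj'
  have hind : LinearIndependent ℂ fun k => (⟨basisVec (z k), hrange k⟩ :
      LinearMap.range (sphereRep hS (toSphere n ⟨Q, hmem⟩))) :=
    LinearIndependent.of_comp (Submodule.subtype _)
      (orthonormal_basisVec.comp z hz).linearIndependent
  exact not_finite_iff_infinite.2 inferInstance hind.finite_of_isNoetherian

end TorusCharacters

section Invariants

open EllTwo

variable {n : ℕ}

theorem finrank_range_antichainMatFix {Q : Finset (Fin n) → (Hn n →L[ℂ] Hn n)}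
    (hQ : ∀ S, IsQProj S (Q S)) (hmem : ∀ S, Q S ∈ Toeplitz n)
    {α : Circle → (QuantumSphere n →+* QuantumSphere n)} {A : Finset (Finset (Fin n))}
    (hA : IsAntichain (· ⊆ ·) (A : Set (Finset (Fin n)))) {l : Finset (Fin n) → ℕ}
    (hl : ∀ S ∈ A, 1 ≤ l S) (hfix : ∀ S ∈ A, toSphere n ⟨Q S, hmem S⟩ ∈ fixedSubring α)
    {S : Finset (Fin n)} (hS : S.Nonempty) {N : ℕ}
    (f : ((S : {x // x ∈ A}) × Fin (l S.1)) ↪ Fin N) :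
    Module.finrank ℂ (LinearMap.range (matrixOperator
      (((sphereRep hS).comp (fixedSubring α).subtype).mapMatrix
        (padMat f (antichainMatFix α A l (fun S => toSphere n ⟨Q S, hmem S⟩) hfix))))) =
      if S ∈ A then l S else 0 := by
  classical
  let d : ((S : {x // x ∈ A}) × Fin (l S.1)) → Module.End ℂ (ComplSpace S) :=
    fun p => sphereRep hS (toSphere n ⟨Q p.1.1, hmem p.1.1⟩)
  have hmap : ((sphereRep hS).comp (fixedSubring α).subtype).mapMatrix
      (padMat f (antichainMatFix α A l (fun S => toSphere n ⟨Q S, hmem S⟩) hfix)) =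
      padMat f (Matrix.diagonal d) := by
    rw [map_padMat, antichainMatFix, RingHom.mapMatrix_apply,
      Matrix.diagonal_map (map_zero _)]
    rfl
  rw [hmap]
  by_cases hlt : ∃ S' ∈ A, S ⊂ S'
  · obtain ⟨S', hS', hSS'⟩ := hlt
    have hSA : S ∉ A := fun hSA => hSS'.ne (hA.eq hSA hS' hSS'.subset)
    rw [if_neg hSA]
    exact finrank_range_padMat_diagonal_eq_zero f d ⟨⟨S', hS'⟩, ⟨0, hl S' hS'⟩⟩
      (not_finiteDimensional_range_sphereRep_proj hS hSS' (hQ S') (hmem S'))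
  · have hzero : ∀ p : (S : {x // x ∈ A}) × Fin (l S.1), p.1.1 ≠ S → d p = 0 := fun p hp =>
      sphereRep_proj_eq_zero hS
        (fun hsub => hlt ⟨p.1.1, p.1.2, hsub.ssubset_of_ne hp.symm⟩) (hQ _) _
    have hself : ∀ p : (S : {x // x ∈ A}) × Fin (l S.1), p.1.1 = S →
        LinearMap.range (d p) = Submodule.span ℂ {(basisVec 0 : ComplSpace S)} := by
      rintro ⟨⟨S', hS'⟩, k⟩ rfl
      exact range_sphereRep_proj_self hS (hQ _) _
    have hne : (basisVec 0 : ComplSpace S) ≠ 0 := orthonormal_basisVec.ne_zero 0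
    have hrank : ∀ p, Module.finrank ℂ (LinearMap.range (d p)) = if p.1.1 = S then 1 else 0 := by
      intro p
      split_ifs with hp
      · rw [hself p hp, finrank_span_singleton hne]
      · rw [hzero p hp, LinearMap.range_zero, finrank_bot]
    rw [finrank_range_padMat_diagonal f d, Finset.sum_congr rfl fun p _ => hrank p,
      Fintype.sum_sigma]
    · have hinner : ∀ x : {x // x ∈ A}, (∑ _k : Fin (l x.1), if x.1 = S then 1 else 0) =
          if x.1 = S then l x.1 else 0 := by
        intro x
        split_ifs <;> simp
      refine (Finset.sum_congr rfl fun x _ => hinner x).trans ?_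
      rw [Finset.univ_eq_attach, Finset.sum_attach A fun S' => if S' = S then l S' else 0,
        Finset.sum_ite_eq']
    · intro p
      by_cases hp : p.1.1 = S
      · rw [hself p hp]
        infer_instance
      · rw [hzero p hp, LinearMap.range_zero]
        infer_instance

theorem gauge_conj_proj {S : Finset (Fin n)} {Q V : Hn n →L[ℂ] Hn n} (hQ : IsQProj S Q)
    {ζ : Circle} (hV : ∀ z, V (delta z) = ((ζ : ℂ) ^ (∑ i, z i)) • delta z) :
    V * Q * star V = Q := by
  have hstar : ∀ z, star V (delta z) = star ((ζ : ℂ) ^ (∑ i, z i)) • delta z := by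
    intro z
    ext u
    rw [ContinuousLinearMap.star_eq_adjoint, adjoint_apply, ← delta_eq_basisVec, hV,
      inner_smul_left, delta_eq_basisVec, inner_basisVec, lp.coeFn_smul, Pi.smul_apply,
      delta_eq_basisVec, basisVec_apply]
    split_ifs with h
    · rw [h]
      rfl
    · simp
  refine clm_ext fun z => ?_
  rw [← delta_eq_basisVec, mul_apply_eq_comp, mul_apply_eq_comp, hstar, map_smul, map_smul, hQ z]
  split_ifs
  · rw [hV, smul_smul]
    have hone : star ((ζ : ℂ) ^ (∑ i, z i)) * (ζ : ℂ) ^ (∑ i, z i) = 1 := by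
      rw [Complex.star_def, ← Complex.normSq_eq_conj_mul_self, map_pow, Circle.normSq_coe]
      simp
    rw [hone, one_smul]
  · rw [map_zero, smul_zero]

end Invariants

theorem stmt9 (n : ℕ) (hn : 1 ≤ n)
    (Q : Finset (Fin n) → (Hn n →L[ℂ] Hn n))
    (hQ : ∀ S, IsQProj S (Q S)) (hmem : ∀ S, Q S ∈ Toeplitz n)
    (V : Circle → (Hn n →L[ℂ] Hn n))
    (hV : ∀ (ζ : Circle) (z : Fin n → ℕ),
      V ζ (delta z) = ((ζ : ℂ) ^ (∑ i, z i)) • delta z)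
    (hconj : ∀ (ζ : Circle) (T : Hn n →L[ℂ] Hn n), T ∈ Toeplitz n →
      V ζ * T * star (V ζ) ∈ Toeplitz n)
    (α : Circle → (QuantumSphere n →+* QuantumSphere n))
    (hα : ∀ (ζ : Circle) (T : Hn n →L[ℂ] Hn n) (hT : T ∈ Toeplitz n),
      α ζ (toSphere n ⟨T, hT⟩) = toSphere n ⟨V ζ * T * star (V ζ), hconj ζ T hT⟩) :
    (∀ S : Finset (Fin n), S.Nonempty →
      toSphere n ⟨Q S, hmem S⟩ ∈ fixedSubring α) ∧
    (∀ hfix : ∀ S : Finset (Fin n), S.Nonempty →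
        toSphere n ⟨Q S, hmem S⟩ ∈ fixedSubring α,
      ∀ A A' : Finset (Finset (Fin n)),
      ∀ hAne : ∀ S ∈ A, S.Nonempty, ∀ hA'ne : ∀ S ∈ A', S.Nonempty,
      IsAntichain (· ⊆ ·) (A : Set (Finset (Fin n))) →
      IsAntichain (· ⊆ ·) (A' : Set (Finset (Fin n))) →
      ∀ l l' : Finset (Fin n) → ℕ, (∀ S ∈ A, 1 ≤ l S) → (∀ S ∈ A', 1 ≤ l' S) →
      ¬(A = A' ∧ ∀ S ∈ A, l S = l' S) →
      ¬ IdemEquiv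
        (antichainMatFix α A l (fun S => toSphere n ⟨Q S, hmem S⟩)
          (fun S hS => hfix S (hAne S hS)))
        (antichainMatFix α A' l' (fun S => toSphere n ⟨Q S, hmem S⟩)
          (fun S hS => hfix S (hA'ne S hS)))) := by
  refine ⟨fun S _ ζ => ?_, ?_⟩
  · rw [hα]
    congr 2
    exact gauge_conj_proj (hQ S) (hV ζ)
  · rintro hfix A A' hAne hA'ne hA hA' l l' hl hl' hne ⟨N, f, g, U, hU⟩
    refine hne ?_
    have key : ∀ S : Finset (Fin n), S.Nonempty →
        (if S ∈ A then l S else 0) = if S ∈ A' then l' S else 0 := by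
      intro S hS
      rw [← finrank_range_antichainMatFix hQ hmem hA hl (fun S hS => hfix S (hAne S hS)) hS f,
        ← finrank_range_antichainMatFix hQ hmem hA' hl' (fun S hS => hfix S (hA'ne S hS)) hS g]
      exact finrank_range_eq_of_conj _ U hU
    refine ⟨Finset.ext fun S => ⟨fun hS => ?_, fun hS => ?_⟩, fun S hS => ?_⟩
    · by_contra hS'
      have h₁ := key S (hAne S hS)
      rw [if_pos hS, if_neg hS'] at h₁
      have h₂ := hl S hS
      omega
    · by_contra hS'
      have h₁ := key S (hA'ne S hS)
      rw [if_pos hS, if_neg hS'] at h₁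
      have h₂ := hl' S hS
      omega
    · have h₁ := key S (hAne S hS)
      rw [if_pos hS] at h₁
      have h₂ := hl S hS
      split_ifs at h₁
      · exact h₁
      · omega
end
end

section
/- Let n > 2 and let k ≥ 0 be an integer. Let R_k be the orthogonal projection of H_n onto the closed span of {δ_z : z_{n−1} ≥ k} and r_k := ∂(R_k); then r_k is an α-invariant idempotent of A_n, so B_n r_k := {b·r_k : b ∈ B_n} is a left B_n-module, and the quantum line bundle L_k is isomorphic to B_n r_k as left B_n-modules. -/
noncomputable section

open scoped InnerProductSpace

/-- The standard basis vectors of `ℓ²(ℕ^n)` are orthonormal. -/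
theorem delta_orthonormal (n : ℕ) : Orthonormal ℂ (delta : (Fin n → ℕ) → Hn n) := by
  classical
  rw [orthonormal_iff_ite]
  intro z w
  simp only [delta, lp.inner_single_left, lp.single_apply]
  by_cases h : z = w
  · subst h
    simp
  · simp [h]

/-- A vector of `ℓ²(ℕ^n)` vanishes once it is orthogonal to every basis vector. -/
theorem eq_zero_of_inner_delta {n : ℕ} {x : Hn n} (h : ∀ z, ⟪delta z, x⟫_ℂ = 0) : x = 0 := by
  ext z
  simpa [delta, lp.inner_single_left] using h z

/-- Vectors of `ℓ²(ℕ^n)` are determined by their inner products with the basis vectors. -/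
theorem ext_inner_delta {n : ℕ} {x y : Hn n} (h : ∀ z, ⟪delta z, x⟫_ℂ = ⟪delta z, y⟫_ℂ) :
    x = y :=
  sub_eq_zero.mp (eq_zero_of_inner_delta fun z => by rw [inner_sub_right, h z, sub_self])

/-- Bounded operators on `ℓ²(ℕ^n)` are determined by their values on the basis vectors. -/
theorem clm_ext_delta {n : ℕ} {A B : Hn n →L[ℂ] Hn n} (h : ∀ z, A (delta z) = B (delta z)) :
    A = B := by
  have hstar : star A = star B := by
    ext1 x
    refine ext_inner_delta fun z => ?_
    rw [ContinuousLinearMap.star_eq_adjoint, ContinuousLinearMap.star_eq_adjoint,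
      ContinuousLinearMap.adjoint_inner_right, ContinuousLinearMap.adjoint_inner_right, h z]
  exact star_injective hstar

/-- The adjoint of a diagonal operator is diagonal with conjugate entries. -/
theorem star_apply_delta_of_diagonal {n : ℕ} {D : Hn n →L[ℂ] Hn n} {c : (Fin n → ℕ) → ℂ}
    (hD : ∀ z, D (delta z) = c z • delta z) (z : Fin n → ℕ) :
    star D (delta z) = (starRingEnd ℂ (c z)) • delta z := by
  classical
  refine ext_inner_delta fun w => ?_
  rw [ContinuousLinearMap.star_eq_adjoint, ContinuousLinearMap.adjoint_inner_right, hD w,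
    inner_smul_left, inner_smul_right, orthonormal_iff_ite.mp (delta_orthonormal n)]
  by_cases h : w = z
  · rw [h]
  · simp [h]

/-- An injective self-map of `ℕ^n` induces a bounded operator on `ℓ²(ℕ^n)`. -/
theorem exists_clm_apply_delta_of_injective {n : ℕ} {f : (Fin n → ℕ) → (Fin n → ℕ)}
    (hf : Function.Injective f) : ∃ T : Hn n →L[ℂ] Hn n,
      ∀ z, T (delta z) = delta (f z) := by
  have hon := (delta_orthonormal n).comp f hf
  refine ⟨hon.orthogonalFamily.linearIsometry.toContinuousLinearMap, fun z => ?_⟩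
  simp [delta, OrthogonalFamily.linearIsometry_apply_single]

theorem update_add_injective {n : ℕ} (i : Fin n) (k : ℕ) :
    Function.Injective fun z : Fin n → ℕ => Function.update z i (z i + k) := by
  intro z w h
  funext j
  have hj := congrFun h j
  by_cases hji : j = i
  · subst hji
    simpa using hj
  · simpa [hji] using hj

/-- The coordinate shifts exist as bounded operators. -/
theorem exists_isShift {n : ℕ} (i : Fin n) : ∃ S : Hn n →L[ℂ] Hn n, IsShift i S :=
  exists_clm_apply_delta_of_injective (update_add_injective i 1)

/-- The `k`-th power of a coordinate shift raises that coordinate by `k`. -/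
theorem IsShift.pow_apply_delta {n : ℕ} {i : Fin n} {S : Hn n →L[ℂ] Hn n} (hS : IsShift i S)
    (k : ℕ) (z : Fin n → ℕ) : (S ^ k) (delta z) = delta (Function.update z i (z i + k)) := by
  induction k with
  | zero => simp
  | succ k ih =>
    rw [pow_succ', mul_apply_eq_comp, ih, hS]
    simp [add_assoc]

/-- The coordinate shifts belong to the Toeplitz algebra. -/
theorem IsShift.mem_toeplitz {n : ℕ} {i : Fin n} {S : Hn n →L[ℂ] Hn n} (hS : IsShift i S) :
    S ∈ Toeplitz n :=
  StarSubalgebra.le_topologicalClosure _ (StarAlgebra.subset_adjoin ℂ _ ⟨i, hS⟩)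

/-- Powers of coordinate shifts are isometries. -/
theorem IsShift.star_pow_mul_pow {n : ℕ} {i : Fin n} {S : Hn n →L[ℂ] Hn n} (hS : IsShift i S)
    (k : ℕ) : star (S ^ k) * S ^ k = 1 := by
  classical
  refine clm_ext_delta fun z => ext_inner_delta fun w => ?_
  rw [mul_apply_eq_comp, ContinuousLinearMap.star_eq_adjoint,
    ContinuousLinearMap.adjoint_inner_right, hS.pow_apply_delta, hS.pow_apply_delta,
    one_apply_eq_self, orthonormal_iff_ite.mp (delta_orthonormal n),
    orthonormal_iff_ite.mp (delta_orthonormal n)]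
  exact if_congr (update_add_injective i k).eq_iff rfl rfl

/-- The range projection of the `k`-th power of the `i`-th shift is the projection onto the
closed span of the `δ_z` with `z i ≥ k`. -/
theorem IsShift.pow_mul_star_pow_apply_delta {n : ℕ} {i : Fin n} {S : Hn n →L[ℂ] Hn n}
    (hS : IsShift i S) (k : ℕ) (z : Fin n → ℕ) :
    (S ^ k * star (S ^ k)) (delta z) = if k ≤ z i then delta z else 0 := by
  classical
  split_ifs with hk
  · have hz : (S ^ k) (delta (Function.update z i (z i - k))) = delta z := by
      rw [hS.pow_apply_delta]
      simp [hk]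
    rw [← hz, ← mul_apply_eq_comp, mul_assoc, hS.star_pow_mul_pow, mul_one]
  · have hz : star (S ^ k) (delta z) = 0 := by
      refine eq_zero_of_inner_delta fun w => ?_
      rw [ContinuousLinearMap.star_eq_adjoint, ContinuousLinearMap.adjoint_inner_right,
        hS.pow_apply_delta, orthonormal_iff_ite.mp (delta_orthonormal n), if_neg]
      rintro rfl
      simp at hk
    rw [mul_apply_eq_comp, hz, map_zero]

theorem circle_pow_mul_conj (ζ : Circle) (m : ℕ) :
    (ζ : ℂ) ^ m * starRingEnd ℂ ((ζ : ℂ) ^ m) = 1 := by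
  rw [Complex.mul_conj, Complex.normSq_eq_norm_sq, norm_pow, Circle.norm_coe]
  simp

/-- Conjugation by the diagonal unitary scales the `k`-th power of a shift by `ζ ^ k`. -/
theorem IsShift.conj_pow {n : ℕ} {i : Fin n} {S : Hn n →L[ℂ] Hn n} (hS : IsShift i S) (k : ℕ)
    {ζ : Circle} {V : Hn n →L[ℂ] Hn n}
    (hV : ∀ z : Fin n → ℕ, V (delta z) = ((ζ : ℂ) ^ (∑ j, z j)) • delta z) :
    V * S ^ k * star V = algebraMap ℂ (Hn n →L[ℂ] Hn n) ((ζ : ℂ) ^ k) * S ^ k := by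
  refine clm_ext_delta fun z => ?_
  have hsum : ∑ j, Function.update z i (z i + k) j = (∑ j, z j) + k := by
    rw [Finset.sum_update_of_mem (Finset.mem_univ i),
      Finset.sum_eq_add_sum_sdiff_singleton_of_mem (Finset.mem_univ i) z]
    ring
  rw [← Algebra.smul_def, mul_apply_eq_comp, mul_apply_eq_comp,
    star_apply_delta_of_diagonal hV, map_smul, map_smul, smul_apply,
    hS.pow_apply_delta, hV, hsum, smul_smul, pow_add, ← mul_assoc,
    mul_comm (starRingEnd ℂ _), circle_pow_mul_conj, one_mul]

/-- Let `α` be a family of ring endomorphisms of `A`, and let `t` be an isometry-like element of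
degree `c` (with left inverse `t'` of degree `c⁻¹ = c'`, and `c` central). Then right
multiplication by `t'` identifies the degree-`c` elements with the left ideal that `t * t'`
generates in the invariant elements. -/
theorem bijOn_mul_right_of_degree {A ι : Type*} [Ring A] {α : ι → A →+* A} {c c' : ι → A}
    {t t' : A} (hc : ∀ ζ a, Commute (c ζ) a) (hcc : ∀ ζ, c ζ * c' ζ = 1)
    (ht : ∀ ζ, α ζ t = c ζ * t) (ht' : ∀ ζ, α ζ t' = c' ζ * t') (htt : t' * t = 1) :
    Set.BijOn (fun a => a * t') {a | ∀ ζ, α ζ a = c ζ * a}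
      {y | ∃ b, (∀ ζ, α ζ b = b) ∧ y = b * (t * t')} := by
  refine ⟨?_, ?_, ?_⟩
  · intro a ha
    refine ⟨a * t', fun ζ => ?_, ?_⟩
    · rw [map_mul, ha ζ, ht' ζ, (hc ζ a).eq, mul_assoc, ← mul_assoc (c ζ), hcc, one_mul]
    · simp only [mul_assoc]
      rw [← mul_assoc t' t, htt, one_mul]
  · intro a _ b _ hab
    have := congrArg (fun x => x * t) hab
    simpa only [mul_assoc, htt, mul_one] using this
  · rintro _ ⟨b, hb, rfl⟩
    refine ⟨b * t, fun ζ => ?_, mul_assoc _ _ _⟩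
    rw [map_mul, hb ζ, ht ζ, ← mul_assoc, ← (hc ζ b).eq, mul_assoc]

theorem stmt10 (n : ℕ) (hn : 2 < n) (k : ℕ)
    (V : Circle → (Hn n →L[ℂ] Hn n))
    (hV : ∀ (ζ : Circle) (z : Fin n → ℕ),
      V ζ (delta z) = ((ζ : ℂ) ^ (∑ i, z i)) • delta z)
    (hconj : ∀ (ζ : Circle) (T : Hn n →L[ℂ] Hn n), T ∈ Toeplitz n →
      V ζ * T * star (V ζ) ∈ Toeplitz n)
    (α : Circle → (QuantumSphere n →+* QuantumSphere n))
    (hα : ∀ (ζ : Circle) (T : Hn n →L[ℂ] Hn n) (hT : T ∈ Toeplitz n),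
      α ζ (toSphere n ⟨T, hT⟩) = toSphere n ⟨V ζ * T * star (V ζ), hconj ζ T hT⟩)
    -- `R` is the orthogonal projection onto the closed span of `{δ_z : z_{n-1} ≥ k}`
    (R : Hn n →L[ℂ] Hn n)
    (hR : ∀ z : Fin n → ℕ,
      R (delta z) = if k ≤ z ⟨n - 1, by omega⟩ then delta z else 0)
    (hRmem : R ∈ Toeplitz n) :
    -- `r_k := ∂(R_k)` is an `α`-invariant idempotent of `A_n`
    (∀ ζ : Circle, α ζ (toSphere n ⟨R, hRmem⟩) = toSphere n ⟨R, hRmem⟩) ∧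
    toSphere n ⟨R, hRmem⟩ * toSphere n ⟨R, hRmem⟩ = toSphere n ⟨R, hRmem⟩ ∧
    -- the quantum line bundle `L_k` is isomorphic to `B_n r_k` as left `B_n`-modules
    (∃ e : QuantumSphere n → QuantumSphere n,
      Set.BijOn e
        {a : QuantumSphere n | ∀ ζ : Circle,
          α ζ a = toSphere n
            ⟨algebraMap ℂ (Hn n →L[ℂ] Hn n) ((ζ : ℂ) ^ k),
              (Toeplitz n).algebraMap_mem _⟩ * a}
        {y : QuantumSphere n | ∃ b ∈ fixedSubring α, y = b * toSphere n ⟨R, hRmem⟩} ∧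
      (∀ x ∈ {a : QuantumSphere n | ∀ ζ : Circle,
          α ζ a = toSphere n
            ⟨algebraMap ℂ (Hn n →L[ℂ] Hn n) ((ζ : ℂ) ^ k),
              (Toeplitz n).algebraMap_mem _⟩ * a},
        ∀ y ∈ {a : QuantumSphere n | ∀ ζ : Circle,
          α ζ a = toSphere n
            ⟨algebraMap ℂ (Hn n →L[ℂ] Hn n) ((ζ : ℂ) ^ k),
              (Toeplitz n).algebraMap_mem _⟩ * a},
        e (x + y) = e x + e y) ∧
      (∀ b ∈ fixedSubring α,
        ∀ x ∈ {a : QuantumSphere n | ∀ ζ : Circle,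
          α ζ a = toSphere n
            ⟨algebraMap ℂ (Hn n →L[ℂ] Hn n) ((ζ : ℂ) ^ k),
              (Toeplitz n).algebraMap_mem _⟩ * a},
        e (b * x) = b * e x)) := by
  obtain ⟨S, hS⟩ := exists_isShift (⟨n - 1, by omega⟩ : Fin n)
  have hT : S ^ k ∈ Toeplitz n := pow_mem hS.mem_toeplitz k
  have hT' : star (S ^ k) ∈ Toeplitz n := star_mem hT
  have hRT : R = S ^ k * star (S ^ k) :=
    clm_ext_delta fun z => by rw [hR, hS.pow_mul_star_pow_apply_delta]
  subst hRT
  let t := toSphere n ⟨S ^ k, hT⟩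
  let t' := toSphere n ⟨star (S ^ k), hT'⟩
  let c : Circle → QuantumSphere n := fun ζ => toSphere n
    ⟨algebraMap ℂ (Hn n →L[ℂ] Hn n) ((ζ : ℂ) ^ k), (Toeplitz n).algebraMap_mem _⟩
  let c' : Circle → QuantumSphere n := fun ζ => toSphere n
    ⟨algebraMap ℂ (Hn n →L[ℂ] Hn n) (starRingEnd ℂ ((ζ : ℂ) ^ k)),
      (Toeplitz n).algebraMap_mem _⟩
  have hr : toSphere n ⟨S ^ k * star (S ^ k), hRmem⟩ = t * t' :=
    map_mul (toSphere n) ⟨S ^ k, hT⟩ ⟨star (S ^ k), hT'⟩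
  have htt : t' * t = 1 := by
    rw [← map_mul, ← map_one (toSphere n)]
    exact congrArg _ (Subtype.ext (hS.star_pow_mul_pow k))
  have hc : ∀ ζ a, Commute (c ζ) a := by
    intro ζ a
    obtain ⟨a, rfl⟩ := (compactIdeal n).ringCon.mk'_surjective a
    change c ζ * toSphere n a = toSphere n a * c ζ
    rw [← map_mul, ← map_mul]
    exact congrArg _ (Subtype.ext (Algebra.commutes _ _))
  have hcc : ∀ ζ, c ζ * c' ζ = 1 := by
    intro ζ
    rw [← map_mul, ← map_one (toSphere n)]
    refine congrArg _ (Subtype.ext ?_)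
    change algebraMap ℂ (Hn n →L[ℂ] Hn n) _ * algebraMap ℂ (Hn n →L[ℂ] Hn n) _ = 1
    rw [← map_mul, circle_pow_mul_conj, map_one]
  have ht : ∀ ζ, α ζ t = c ζ * t := by
    intro ζ
    rw [hα, ← map_mul]
    exact congrArg _ (Subtype.ext (hS.conj_pow k (hV ζ)))
  have ht' : ∀ ζ, α ζ t' = c' ζ * t' := by
    intro ζ
    rw [hα, ← map_mul]
    refine congrArg _ (Subtype.ext ?_)
    have h := congrArg star (hS.conj_pow k (hV ζ))
    rw [← Algebra.smul_def, star_smul, star_mul, star_mul, star_star, ← mul_assoc,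
      Algebra.smul_def] at h
    exact h
  rw [hr]
  refine ⟨fun ζ => ?_, ?_, fun a => a * t',
    bijOn_mul_right_of_degree hc hcc ht ht' htt, fun x _ y _ => add_mul x y t',
    fun b _ x _ => mul_assoc b x t'⟩
  · rw [map_mul, ht, ht', (hc ζ t).eq, mul_assoc, ← mul_assoc (c ζ), hcc, one_mul]
  · rw [mul_assoc, ← mul_assoc t' t, htt, one_mul]
end
end
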